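/- Fix b > 0 and β > 0 with b·β > 1, and let p₊(β) be the unique p ∈ (0,1) with p = tanh(b·β·p). Then the function m ↦ F_{b,β}(0,m) = −b·m²/2 + β⁻¹·c(m) is strictly increasing on the interval [p₊(β), 1] and strictly decreasing on the interval [−1, −p₊(β)]. -/

import Mathlib

/-- The symmetrized entropy function
`c(m) = ((1+m)/2)·log((1+m)/2) + ((1−m)/2)·log((1−m)/2)` (with `c(±1) = 0`,
as `Real.log 0 = 0` in Lean). -/
noncomputable def cEnt (m : ℝ) : ℝ :=
  ((1 + m) / 2) * Real.log ((1 + m) / 2) + ((1 - m) / 2) * Real.log ((1 - m) / 2)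

open Set in
theorem Real.hasDerivAt_artanh_of_mem_Ioo {x : ℝ} (hx : x ∈ Ioo (-1 : ℝ) 1) :
    HasDerivAt Real.artanh (1 - x ^ 2)⁻¹ x := by
  have h1 : 1 + x ≠ 0 := by linarith [hx.1]
  have h2 : 1 - x ≠ 0 := by linarith [hx.2]
  have h3 : 1 - x ^ 2 ≠ 0 := by
    rw [show 1 - x ^ 2 = (1 + x) * (1 - x) by ring]
    exact mul_ne_zero h1 h2
  have h := ((((hasDerivAt_id x).const_add 1).div ((hasDerivAt_id x).const_sub 1) h2).log
    (div_ne_zero h1 h2)).const_mul (1 / 2 : ℝ)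
  have he : Real.artanh =ᶠ[nhds x]
      fun y => 1 / 2 * Real.log ((1 + y) / (1 - y)) := by
    filter_upwards [Ioo_mem_nhds hx.1 hx.2] with y hy
    exact Real.artanh_eq_half_log (Ioo_subset_Icc_self hy)
  refine (h.congr_of_eventuallyEq he).congr_deriv ?_
  simp only [id, Pi.div_apply]
  field_simp
  ring

open Set in
theorem Real.strictConvexOn_artanh : StrictConvexOn ℝ (Ico (0 : ℝ) 1) Real.artanh := by
  have hmem : ∀ {x : ℝ}, x ∈ Ico (0 : ℝ) 1 → x ∈ Ioo (-1 : ℝ) 1 :=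
    fun hx => ⟨by linarith [hx.1], hx.2⟩
  refine StrictMonoOn.strictConvexOn_of_deriv (convex_Ico 0 1)
    (fun x hx => (hasDerivAt_artanh_of_mem_Ioo (hmem hx)).continuousAt.continuousWithinAt) ?_
  rw [interior_Ico]
  intro x hx y hy hxy
  rw [(hasDerivAt_artanh_of_mem_Ioo (hmem (Ioo_subset_Ico_self hx))).deriv,
    (hasDerivAt_artanh_of_mem_Ioo (hmem (Ioo_subset_Ico_self hy))).deriv]
  have := hx.1
  have := hy.2
  have := hy.1
  exact inv_strictAnti₀ (by nlinarith) (by nlinarith)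

open Set in
/-- Beyond a positive fixed point `p = tanh (k p)`, the graph of `artanh` lies strictly above
the line of slope `k`. -/
theorem Real.mul_lt_artanh_of_eq_tanh {k p m : ℝ} (hp : 0 < p) (hpk : p = Real.tanh (k * p))
    (hpm : p < m) (hm : m < 1) : k * m < Real.artanh m := by
  have hpa : Real.artanh p = k * p := by
    conv_lhs => rw [hpk]
    exact Real.artanh_tanh _
  have hm0 : 0 < m := hp.trans hpm
  have h := strictConvexOn_artanh.2 (left_mem_Ico.2 one_pos) ⟨hm0.le, hm⟩ hm0.ne
    (sub_pos.2 ((div_lt_one hm0).2 hpm)) (div_pos hp hm0) (sub_add_cancel 1 (p / m))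
  simp only [smul_eq_mul, mul_zero, zero_add, Real.artanh_zero, div_mul_cancel₀ p hm0.ne',
    hpa] at h
  rw [div_mul_eq_mul_div, lt_div_iff₀ hm0] at h
  nlinarith

theorem continuous_cEnt : Continuous cEnt :=
  (Real.continuous_mul_log.comp (by fun_prop : Continuous fun m : ℝ => (1 + m) / 2)).add
    (Real.continuous_mul_log.comp (by fun_prop : Continuous fun m : ℝ => (1 - m) / 2))

theorem cEnt_neg (m : ℝ) : cEnt (-m) = cEnt m := by
  simp only [cEnt, sub_neg_eq_add, ← sub_eq_add_neg]
  ring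

theorem hasDerivAt_cEnt {m : ℝ} (hm : m ∈ Set.Ioo (-1 : ℝ) 1) :
    HasDerivAt cEnt (Real.artanh m) m := by
  have h1 : 1 + m ≠ 0 := by linarith [hm.1]
  have h2 : 1 - m ≠ 0 := by linarith [hm.2]
  have h1' : (1 + m) / 2 ≠ 0 := div_ne_zero h1 two_ne_zero
  have h2' : (1 - m) / 2 ≠ 0 := div_ne_zero h2 two_ne_zero
  have d1 := (Real.hasDerivAt_mul_log h1').comp m
    (((hasDerivAt_id m).const_add 1).div_const 2)
  have d2 := (Real.hasDerivAt_mul_log h2').comp m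
    (((hasDerivAt_id m).const_sub 1).div_const 2)
  refine (d1.add d2).congr_deriv ?_
  rw [Real.artanh_eq_half_log (Set.Ioo_subset_Icc_self hm), Real.log_div h1 h2,
    Real.log_div h1 two_ne_zero, Real.log_div h2 two_ne_zero]
  ring


/-- For `b·β > 1`, the function
`m ↦ F_{b,β}(0,m) = −b·m²/2 + β⁻¹·c(m)` is strictly increasing on
`[p₊(β), 1]` and strictly decreasing on `[−1, −p₊(β)]`. -/
theorem curie_weiss_F_monotone_on_stable_branches
    (b β : ℝ) (hb : 0 < b) (hβ : 0 < β) (hbβ : 1 < b * β)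
    (pPlus : ℝ) (hpPlus : pPlus ∈ Set.Ioo (0 : ℝ) 1)
    (hpPluseq : pPlus = Real.tanh (b * β * pPlus)) :
    StrictMonoOn (fun m : ℝ => -b * m ^ 2 / 2 + β⁻¹ * cEnt m) (Set.Icc pPlus 1) ∧
    StrictAntiOn (fun m : ℝ => -b * m ^ 2 / 2 + β⁻¹ * cEnt m)
      (Set.Icc (-1 : ℝ) (-pPlus)) := by
  have hmono : StrictMonoOn (fun m : ℝ => -b * m ^ 2 / 2 + β⁻¹ * cEnt m)
      (Set.Icc pPlus 1) := by
    refine strictMonoOn_of_deriv_pos (convex_Icc _ _) ?_ fun m hm => ?_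
    · have := continuous_cEnt
      fun_prop
    rw [interior_Icc] at hm
    have hm' : m ∈ Set.Ioo (-1 : ℝ) 1 := ⟨by linarith [hm.1, hpPlus.1], hm.2⟩
    have hd := ((((hasDerivAt_id m).pow 2).const_mul (-b)).div_const 2).add
      ((hasDerivAt_cEnt hm').const_mul β⁻¹)
    have hlt := Real.mul_lt_artanh_of_eq_tanh hpPlus.1 hpPluseq hm.1 hm.2
    have hlt' : b * m < β⁻¹ * Real.artanh m := by
      rw [inv_mul_eq_div, lt_div_iff₀ hβ]
      linarith
    refine lt_of_lt_of_eq (sub_pos.2 hlt') (Eq.trans ?_ hd.deriv.symm)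
    simp only [id, Nat.cast_ofNat]
    ring
  refine ⟨hmono, fun x hx y hy hxy => ?_⟩
  have h := hmono (a := -y) ⟨by linarith [hy.2], by linarith [hy.1]⟩
    (b := -x) ⟨by linarith [hx.2], by linarith [hx.1]⟩ (neg_lt_neg hxy)
  simpa only [cEnt_neg, neg_sq] using h
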